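/- Let 0<q<1, let L>−1 and η be real numbers, and let ρ∈ℝ with |ρ|<q^{−1/2}. Then the q-analogue of the regular Coulomb wave function F_L(η,ρ;q) := (iq^{1/2}ρ;q)_∞ · Σ_{k=0}^{∞} [(−q^{L+iη+1};q)_k(q^{L−iη+1};q)_k/((q;q)_k(q^{2L+2};q)_k)]·(iq^{1/2}ρ)^k is a real number. -/

import Mathlib

open Finset Filter

/-- `rpw q t` is the complex number `q^t` (real power, `q > 0`). -/
noncomputable def rpw (q t : ℝ) : ℂ := ((q ^ t : ℝ) : ℂ)

/-- `qcpow q w = q^w` for complex `w`, with the real logarithm of `q`. -/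
noncomputable def qcpow (q : ℝ) (w : ℂ) : ℂ := Complex.exp (w * (Real.log q : ℂ))

/-- Finite q-shifted factorial `(a; qq)_n`. -/
noncomputable def qPoch (a qq : ℂ) (n : ℕ) : ℂ := ∏ j ∈ Finset.range n, (1 - a * qq ^ j)

/-- Infinite q-shifted factorial `(a; qq)_∞`. -/
noncomputable def qPochInf (a qq : ℂ) : ℂ := ∏' j : ℕ, (1 - a * qq ^ j)

/-- The q-analogue `F_L(η,ρ;q)` of the regular Coulomb wave function. -/
noncomputable def qCoulomb (q L η : ℝ) (ρ : ℂ) : ℂ :=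
  qPochInf (Complex.I * rpw q (1/2) * ρ) (q : ℂ) *
  ∑' k : ℕ,
    (qPoch (-(qcpow q ((L : ℂ) + (η : ℂ) * Complex.I + 1))) (q : ℂ) k *
     qPoch (qcpow q ((L : ℂ) - (η : ℂ) * Complex.I + 1)) (q : ℂ) k /
     (qPoch (q : ℂ) (q : ℂ) k * qPoch (rpw q (2*L + 2)) (q : ℂ) k)) *
    (Complex.I * rpw q (1/2) * ρ)^k

/-- A sequence of size `O(v ^ n)` whose `s`-differences are of size `O(w ^ n)` is itself of size
`O(w ^ n)`, as soon as `s * v < 1` and `s * w < 1`. -/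
lemma norm_le_of_norm_sub_mul_le {d : ℕ → ℂ} {s v w C E : ℝ} {N : ℕ} (hs : 0 < s) (hv : 0 < v)
    (hsv : s * v < 1) (hw : 0 < w) (hsw : s * w < 1) (hE : 0 ≤ E)
    (hd : ∀ n, N ≤ n → ‖d n‖ ≤ C * v ^ n)
    (he : ∀ n, N ≤ n → ‖d n - s * d (n + 1)‖ ≤ E * w ^ n) :
    ∀ n, N ≤ n → ‖d n‖ ≤ E / (1 - s * w) * w ^ n := by
  intro n hn
  set B := E / (1 - s * w) with hB
  have hB0 : 0 ≤ B := div_nonneg hE (by linarith)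
  have hBE : B - s * w * B = E := by
    rw [hB]
    field_simp [(by linarith : (1 - s * w) ≠ 0)]
  have step : ∀ m, N ≤ m → ‖d m‖ - B * w ^ m ≤ s * (‖d (m + 1)‖ - B * w ^ (m + 1)) := by
    intro m hm
    have h1 : ‖d m‖ ≤ ‖d m - s * d (m + 1)‖ + ‖(s : ℂ) * d (m + 1)‖ := norm_le_norm_sub_add _ _
    rw [norm_mul, Complex.norm_real, Real.norm_of_nonneg hs.le] at h1
    have h2 := he m hm
    have h3 : E * w ^ m = B * w ^ m - s * (B * w ^ (m + 1)) := by rw [← hBE]; ring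
    linarith
  have iter : ∀ k, ‖d n‖ - B * w ^ n ≤ s ^ k * (‖d (n + k)‖ - B * w ^ (n + k)) := by
    intro k
    induction k with
    | zero => simp
    | succ k ih =>
      refine ih.trans ?_
      rw [pow_succ, mul_assoc]
      exact mul_le_mul_of_nonneg_left (step (n + k) (by omega)) (by positivity)
  have bound : ∀ k, ‖d n‖ - B * w ^ n ≤ C * v ^ n * (s * v) ^ k := by
    intro k
    refine (iter k).trans ?_
    have h1 : ‖d (n + k)‖ - B * w ^ (n + k) ≤ C * v ^ (n + k) := by
      have := hd (n + k) (by omega)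
      have : 0 ≤ B * w ^ (n + k) := by positivity
      linarith
    calc s ^ k * (‖d (n + k)‖ - B * w ^ (n + k)) ≤ s ^ k * (C * v ^ (n + k)) := by gcongr
      _ = C * v ^ n * (s * v) ^ k := by rw [mul_pow, pow_add]; ring
  have lim : Tendsto (fun k : ℕ => C * v ^ n * (s * v) ^ k) atTop (nhds (C * v ^ n * 0)) :=
    (tendsto_pow_atTop_nhds_zero_of_lt_one (by positivity) hsv).const_mul _
  have := ge_of_tendsto' lim bound
  linarith

/-- Uniqueness for a second-order linear `q`-recurrence: a solution of size `O(q ^ n)` vanishes. -/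
lemma eq_zero_of_q_recurrence {u : ℕ → ℂ} {q s C : ℝ} {b t : ℂ} (hq0 : 0 < q) (hq1 : q < 1)
    (hs : 0 < s) (hsq : s * q < 1) (hu : ∀ n, ‖u n‖ ≤ C * q ^ n)
    (hrec : ∀ n, u n = (1 + s - b * q ^ n) * u (n + 1)
      - s * (1 + t * (q ^ n) ^ 2) * u (n + 2)) :
    ∀ n, u n = 0 := by
  have hq2 : q ^ 2 < q := by nlinarith
  have hsq2 : s * q ^ 2 < 1 := by nlinarith
  have hC : 0 ≤ C := by simpa using (norm_nonneg _).trans (hu 0)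
  have hqn : ∀ n : ℕ, q ^ n ≤ 1 := fun n => pow_le_one₀ hq0.le hq1.le
  set K := ‖b‖ + s * ‖t‖ with hK
  have hK0 : 0 ≤ K := by positivity
  set K' := K / (1 - s * q ^ 2) / (1 - 1 * q ^ 2) with hK'
  have hK'0 : 0 ≤ K' := div_nonneg (div_nonneg hK0 (by linarith)) (by linarith)
  have gain : ∀ (M : ℝ) (N : ℕ), 0 ≤ M → (∀ n, N ≤ n → ‖u n‖ ≤ M * q ^ n) →
      ∀ n, N ≤ n → ‖u n‖ ≤ K' * M * (q ^ 2) ^ n := by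
    intro M N hM h
    have hd : ∀ n, N ≤ n → ‖u n - u (n + 1)‖ ≤ (2 * M) * q ^ n := by
      intro n hn
      have h1 := h n hn
      have h2 := h (n + 1) (by omega)
      have h3 : M * q ^ (n + 1) ≤ M * q ^ n :=
        mul_le_mul_of_nonneg_left (pow_le_pow_of_le_one hq0.le hq1.le (by omega)) hM
      have := norm_sub_le (u n) (u (n + 1))
      linarith
    have he : ∀ n, N ≤ n →
        ‖(u n - u (n + 1)) - s * (u (n + 1) - u (n + 1 + 1))‖ ≤ (K * M) * (q ^ 2) ^ n := by
      intro n hn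
      have h1 : (u n - u (n + 1)) - s * (u (n + 1) - u (n + 1 + 1))
          = -(b * q ^ n * u (n + 1)) - s * t * (q ^ n) ^ 2 * u (n + 2) := by
        rw [hrec n]; ring
      have h2 : ‖u (n + 1)‖ ≤ M * q ^ n := (h (n + 1) (by omega)).trans
        (mul_le_mul_of_nonneg_left (pow_le_pow_of_le_one hq0.le hq1.le (by omega)) hM)
      have h3 : ‖u (n + 2)‖ ≤ M := (h (n + 2) (by omega)).trans
        (mul_le_of_le_one_right hM (hqn _))
      rw [h1]
      refine (norm_sub_le _ _).trans ?_
      rw [norm_neg]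
      simp only [norm_mul, norm_pow, Complex.norm_real, Real.norm_of_nonneg hq0.le,
        Real.norm_of_nonneg hs.le]
      calc ‖b‖ * q ^ n * ‖u (n + 1)‖ + s * ‖t‖ * (q ^ n) ^ 2 * ‖u (n + 2)‖
          ≤ ‖b‖ * q ^ n * (M * q ^ n) + s * ‖t‖ * (q ^ n) ^ 2 * M := by gcongr
        _ = K * M * (q ^ 2) ^ n := by rw [hK, ← pow_mul, ← pow_mul, mul_comm 2 n, pow_mul]; ring
    have h1 := norm_le_of_norm_sub_mul_le hs hq0 hsq (by positivity) hsq2 (by positivity) hd he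
    have h2 := norm_le_of_norm_sub_mul_le (d := u) (s := 1) (v := q) (w := q ^ 2) (C := M)
      (E := K * M / (1 - s * q ^ 2)) (N := N) one_pos hq0 (by linarith) (by positivity)
      (by linarith) (div_nonneg (by positivity) (by linarith)) h (by simpa using h1)
    intro n hn
    refine (h2 n hn).trans (le_of_eq ?_)
    rw [hK']
    ring
  obtain ⟨N, hN⟩ : ∃ N : ℕ, K' * q ^ N ≤ 1 / 2 := by
    have lim : Tendsto (fun k : ℕ => K' * q ^ k) atTop (nhds (K' * 0)) :=
      (tendsto_pow_atTop_nhds_zero_of_lt_one hq0.le hq1).const_mul _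
    rw [mul_zero] at lim
    exact (lim.eventually_le_const (by norm_num : (0 : ℝ) < 1 / 2)).exists
  have halve : ∀ j : ℕ, ∀ n, N ≤ n → ‖u n‖ ≤ C * (1 / 2) ^ j * q ^ n := by
    intro j
    induction j with
    | zero => intro n _; simpa using hu n
    | succ j ih =>
      intro n hn
      have hKn : K' * q ^ n ≤ 1 / 2 :=
        (mul_le_mul_of_nonneg_left (pow_le_pow_of_le_one hq0.le hq1.le hn) hK'0).trans hN
      calc ‖u n‖ ≤ K' * (C * (1 / 2) ^ j) * (q ^ 2) ^ n := gain _ N (by positivity) ih n hn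
        _ = (K' * q ^ n) * (C * (1 / 2) ^ j * q ^ n) := by
          rw [← pow_mul, mul_comm 2 n, pow_mul]; ring
        _ ≤ (1 / 2) * (C * (1 / 2) ^ j * q ^ n) := by gcongr
        _ = C * (1 / 2) ^ (j + 1) * q ^ n := by ring
  have tail : ∀ n, N ≤ n → u n = 0 := by
    intro n hn
    have lim : Tendsto (fun j : ℕ => C * (1 / 2 : ℝ) ^ j * q ^ n) atTop
        (nhds (C * 0 * q ^ n)) :=
      ((tendsto_pow_atTop_nhds_zero_of_lt_one (by norm_num) (by norm_num)).const_mul _).mul_const _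
    have := ge_of_tendsto' lim fun j => halve j n hn
    rw [mul_zero, zero_mul] at this
    exact norm_le_zero_iff.mp this
  have back : ∀ m n, N ≤ n + m → u n = 0 := by
    intro m
    induction m with
    | zero => exact fun n hn => tail n hn
    | succ m ih =>
      intro n hn
      rw [hrec n, ih (n + 1) (by omega), ih (n + 2) (by omega)]
      ring
  exact fun n => back N n (by omega)

lemma summable_norm_mul_pow {q : ℝ} (hq0 : 0 < q) (hq1 : q < 1) (z : ℂ) :
    Summable fun j : ℕ => ‖-(z * (q : ℂ) ^ j)‖ := by
  simp only [norm_neg, norm_mul, norm_pow, Complex.norm_real, Real.norm_of_nonneg hq0.le]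
  exact (summable_geometric_of_lt_one hq0.le hq1).mul_left _

lemma multipliable_qPochInf {q : ℝ} (hq0 : 0 < q) (hq1 : q < 1) (z : ℂ) :
    Multipliable fun j : ℕ => 1 - z * (q : ℂ) ^ j := by
  simpa only [sub_eq_add_neg] using
    multipliable_one_add_of_summable (summable_norm_mul_pow hq0 hq1 z)

lemma qPochInf_eq_mul {q : ℝ} (hq0 : 0 < q) (hq1 : q < 1) (z : ℂ) :
    qPochInf z q = (1 - z) * qPochInf (z * q) q := by
  have h : (fun j : ℕ => 1 - z * (q : ℂ) ^ (j + 1)) = fun j : ℕ => 1 - z * q * (q : ℂ) ^ j := by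
    funext j; ring
  rw [qPochInf, qPochInf, tprod_eq_zero_mul' (h ▸ multipliable_qPochInf hq0 hq1 (z * q)), h]
  simp

lemma norm_qPochInf_sub_one_le {q : ℝ} (hq0 : 0 < q) (hq1 : q < 1) (z : ℂ) :
    ‖qPochInf z q - 1‖ ≤ Real.exp (‖z‖ * (1 - q)⁻¹) - 1 := by
  have lim := (multipliable_qPochInf hq0 hq1 z).hasProd.tendsto_prod_nat
  refine le_of_tendsto' (lim.sub_const 1).norm fun n => ?_
  have h := Finset.norm_prod_one_add_sub_one_le (range n) fun j => -(z * (q : ℂ) ^ j)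
  simp only [← sub_eq_add_neg] at h
  refine h.trans ?_
  gcongr
  refine ((summable_norm_mul_pow hq0 hq1 z).sum_le_tsum _ fun _ _ => norm_nonneg _).trans ?_
  simp only [norm_neg, norm_mul, norm_pow, Complex.norm_real, Real.norm_of_nonneg hq0.le]
  rw [tsum_mul_left, tsum_geometric_of_lt_one hq0.le hq1]

lemma qPoch_succ (a p : ℂ) (n : ℕ) : qPoch a p (n + 1) = qPoch a p n * (1 - a * p ^ n) := by
  rw [qPoch, qPoch, prod_range_succ]

/-- The coefficients of the basic hypergeometric series `₂φ₁(a, b; c; q, ·)`. -/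
noncomputable def phiCoeff (a b c p : ℂ) (k : ℕ) : ℂ :=
  qPoch a p k * qPoch b p k / (qPoch p p k * qPoch c p k)

/-- The basic hypergeometric series `₂φ₁(a, b; c; q, z)`. -/
noncomputable def phi (a b c p z : ℂ) : ℂ := ∑' k : ℕ, phiCoeff a b c p k * z ^ k

lemma phiCoeff_succ (a b c p : ℂ) (k : ℕ) :
    phiCoeff a b c p (k + 1) = phiCoeff a b c p k *
      ((1 - a * p ^ k) * (1 - b * p ^ k) / ((1 - p * p ^ k) * (1 - c * p ^ k))) := by
  simp only [phiCoeff, qPoch_succ]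
  rw [div_mul_div_comm]
  congr 1 <;> ring

lemma one_sub_mul_pow_ne_zero {q : ℝ} (hq0 : 0 < q) (hq1 : q < 1) {c : ℂ} (hc : ‖c‖ < 1) (k : ℕ) :
    1 - c * (q : ℂ) ^ k ≠ 0 := by
  intro h
  have h1 : ‖c * (q : ℂ) ^ k‖ = 1 := by rw [← sub_eq_zero.mp h, norm_one]
  rw [norm_mul, norm_pow, Complex.norm_real, Real.norm_of_nonneg hq0.le] at h1
  have : q ^ k ≤ 1 := pow_le_one₀ hq0.le hq1.le
  nlinarith [norm_nonneg c]

lemma phiCoeff_succ_mul {q : ℝ} (hq0 : 0 < q) (hq1 : q < 1) (a b : ℂ) {c : ℂ} (hc : ‖c‖ < 1)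
    (k : ℕ) :
    phiCoeff a b c q (k + 1) * ((1 - q * (q : ℂ) ^ k) * (1 - c * (q : ℂ) ^ k)) =
      phiCoeff a b c q k * ((1 - a * (q : ℂ) ^ k) * (1 - b * (q : ℂ) ^ k)) := by
  have hq : ‖(q : ℂ)‖ < 1 := by rwa [Complex.norm_real, Real.norm_of_nonneg hq0.le]
  rw [phiCoeff_succ, mul_assoc, div_mul_cancel₀]
  exact mul_ne_zero (one_sub_mul_pow_ne_zero hq0 hq1 hq k) (one_sub_mul_pow_ne_zero hq0 hq1 hc k)

lemma summable_phi {q : ℝ} (hq0 : 0 < q) (hq1 : q < 1) (a b c : ℂ) {z : ℂ} (hz : ‖z‖ < 1) :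
    Summable fun k : ℕ => phiCoeff a b c q k * z ^ k := by
  obtain ⟨r, hzr, hr⟩ := exists_between hz
  refine summable_of_ratio_norm_eventually_le hr ?_
  have hlin : ∀ x : ℂ, Tendsto (fun k : ℕ => 1 - x * (q : ℂ) ^ k) atTop (nhds 1) := by
    intro x
    have hq : ‖(q : ℂ)‖ < 1 := by rwa [Complex.norm_real, Real.norm_of_nonneg hq0.le]
    simpa using ((tendsto_pow_atTop_nhds_zero_of_norm_lt_one hq).const_mul x).const_sub 1
  have lim : Tendsto (fun k : ℕ => ‖(1 - a * (q : ℂ) ^ k) * (1 - b * (q : ℂ) ^ k) /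
      ((1 - q * (q : ℂ) ^ k) * (1 - c * (q : ℂ) ^ k)) * z‖) atTop (nhds ‖z‖) := by
    have := ((((hlin a).mul (hlin b)).div ((hlin q).mul (hlin c)) (by simp)).mul_const z).norm
    simpa using this
  filter_upwards [lim.eventually_le_const hzr] with k hk
  rw [phiCoeff_succ, pow_succ]
  calc _ = ‖(1 - a * (q : ℂ) ^ k) * (1 - b * (q : ℂ) ^ k) /
      ((1 - q * (q : ℂ) ^ k) * (1 - c * (q : ℂ) ^ k)) * z‖ * ‖phiCoeff a b c q k * z ^ k‖ := by
        rw [← norm_mul]; congr 1; ring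
    _ ≤ _ := by gcongr

/-- The second-order `q`-difference equation of `₂φ₁`, with `c = s * q`. -/
lemma phi_q_difference {q : ℝ} (hq0 : 0 < q) (hq1 : q < 1) (a b : ℂ) {s : ℂ} (hc : ‖s * q‖ < 1)
    {z : ℂ} (hz : ‖z‖ < 1) :
    (1 - z) * phi a b (s * q) q z =
      (1 + s - (a + b) * z) * phi a b (s * q) q (z * q)
        - (s - a * b * z) * phi a b (s * q) q (z * q ^ 2) := by
  have hqn : ‖(q : ℂ)‖ < 1 := by rwa [Complex.norm_real, Real.norm_of_nonneg hq0.le]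
  have hz1 : ‖z * q‖ < 1 := by
    rw [norm_mul]; nlinarith [norm_nonneg z, norm_nonneg (q : ℂ)]
  have hz2 : ‖z * q ^ 2‖ < 1 := by
    rw [pow_two, ← mul_assoc, norm_mul]; nlinarith [norm_nonneg (z * q), norm_nonneg (q : ℂ)]
  have S0 := (summable_phi hq0 hq1 a b (s * q) hz).hasSum
  have S1 := (summable_phi hq0 hq1 a b (s * q) hz1).hasSum
  have S2 := (summable_phi hq0 hq1 a b (s * q) hz2).hasSum
  have left := (hasSum_nat_add_iff' 1).mpr ((S0.sub (S1.mul_left (1 + s))).add (S2.mul_left s))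
  have right := ((S0.sub (S1.mul_left (a + b))).add (S2.mul_left (a * b))).mul_left z
  simp only [← phi.eq_1] at left right
  have h := left.unique (right.congr_fun fun k => ?_)
  · rw [sum_range_one, pow_zero, pow_zero, pow_zero] at h
    linear_combination h
  · linear_combination z ^ (k + 1) * phiCoeff_succ_mul hq0 hq1 a b hc k

lemma norm_phi_mul_sub_one_le {q : ℝ} (hq0 : 0 < q) (hq1 : q < 1) (a b c : ℂ) {z : ℂ}
    (hz : ‖z‖ < 1) : ∃ C, ∀ n : ℕ, ‖phi a b c q (z * q ^ n) - 1‖ ≤ C * q ^ n := by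
  have S := (summable_phi hq0 hq1 a b c hz).norm
  have S' := (summable_nat_add_iff 1).mpr S
  refine ⟨∑' k : ℕ, ‖phiCoeff a b c q (k + 1) * z ^ (k + 1)‖, fun n => ?_⟩
  have hqn : q ^ n ≤ 1 := pow_le_one₀ hq0.le hq1.le
  have hzn : ‖z * q ^ n‖ < 1 := by
    rw [norm_mul, norm_pow, Complex.norm_real, Real.norm_of_nonneg hq0.le]
    nlinarith [norm_nonneg z]
  have h0 : phi a b c q (z * q ^ n) - 1 =
      ∑' k : ℕ, phiCoeff a b c q (k + 1) * (z * q ^ n) ^ (k + 1) := by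
    rw [phi, (summable_phi hq0 hq1 a b c hzn).tsum_eq_zero_add]
    simp [phiCoeff, qPoch]
  rw [h0, ← tsum_mul_right]
  refine tsum_of_norm_bounded (S'.mul_right _).hasSum fun k => ?_
  rw [mul_pow, ← mul_assoc, norm_mul _ (((q : ℂ) ^ n) ^ (k + 1))]
  gcongr
  rw [norm_pow, norm_pow, Complex.norm_real, Real.norm_of_nonneg hq0.le]
  exact pow_le_of_le_one (by positivity) hqn (by omega)

lemma norm_qPochInf_mul_sub_one_le {q : ℝ} (hq0 : 0 < q) (hq1 : q < 1) (z : ℂ) :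
    ∃ C, ∀ n : ℕ, ‖qPochInf (z * q ^ n) q - 1‖ ≤ C * q ^ n := by
  set x := ‖z‖ * (1 - q)⁻¹ with hx
  have hx0 : 0 ≤ x := mul_nonneg (norm_nonneg _) (inv_nonneg.mpr (by linarith))
  refine ⟨x * Real.exp x, fun n => (norm_qPochInf_sub_one_le hq0 hq1 _).trans ?_⟩
  have hqn : q ^ n ≤ 1 := pow_le_one₀ hq0.le hq1.le
  have hqn0 : 0 < q ^ n := by positivity
  have h1 : ‖z * (q : ℂ) ^ n‖ * (1 - q)⁻¹ = x * q ^ n := by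
    rw [norm_mul, norm_pow, Complex.norm_real, Real.norm_of_nonneg hq0.le, hx]; ring
  rw [h1]
  set y := x * q ^ n with hy
  have hy0 : 0 ≤ y := by positivity
  have h2 : Real.exp y - 1 ≤ y * Real.exp y := by
    have h3 := Real.add_one_le_exp (-y)
    have h4 : Real.exp (-y) * Real.exp y = 1 := by rw [← Real.exp_add]; simp
    nlinarith [Real.exp_pos y]
  calc Real.exp y - 1 ≤ y * Real.exp y := h2
    _ ≤ y * Real.exp x := by
      gcongr
      exact mul_le_of_le_one_right hx0 hqn
    _ = x * Real.exp x * q ^ n := by rw [hy]; ring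

/-- The normalised series `(z; q)_∞ ₂φ₁(a, b; c; q, z)` is invariant under complex conjugation when
`z` and `a + b` are purely imaginary and `a * b = -c`, with `0 < c < 1`. -/
lemma conj_qPochInf_mul_phi {q s : ℝ} (hq0 : 0 < q) (hq1 : q < 1) (hs : 0 < s) (hsq : s * q < 1)
    {a b z : ℂ} (hz : ‖z‖ < 1) (hzc : (starRingEnd ℂ) z = -z)
    (hab : (starRingEnd ℂ) (a + b) = -(a + b)) (hprod : a * b = -(s * q)) :
    (starRingEnd ℂ) (qPochInf z q * phi a b (s * q) q z) = qPochInf z q * phi a b (s * q) q z := by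
  set g : ℕ → ℂ := fun n => qPochInf (z * q ^ n) q * phi a b (s * q) q (z * q ^ n) with hg
  have hrec : ∀ n, g n = (1 + s - (a + b) * z * q ^ n) * g (n + 1)
      - s * (1 + (-(q * z) ^ 2) * (q ^ n) ^ 2) * g (n + 2) := by
    intro n
    have hqn : q ^ n ≤ 1 := pow_le_one₀ hq0.le hq1.le
    have hzn : ‖z * q ^ n‖ < 1 := by
      rw [norm_mul, norm_pow, Complex.norm_real, Real.norm_of_nonneg hq0.le]
      nlinarith [norm_nonneg z]
    have hsc : ‖(s : ℂ) * q‖ < 1 := by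
      rwa [norm_mul, Complex.norm_real, Complex.norm_real, Real.norm_of_nonneg hq0.le,
        Real.norm_of_nonneg hs.le]
    have hphi := phi_q_difference hq0 hq1 a b hsc hzn
    have e1 : z * (q : ℂ) ^ n * q = z * q ^ (n + 1) := by ring
    have e2 : z * (q : ℂ) ^ n * q ^ 2 = z * q ^ (n + 2) := by ring
    have e3 : z * (q : ℂ) ^ (n + 1) * q = z * q ^ (n + 2) := by ring
    rw [e1, e2] at hphi
    have hP := qPochInf_eq_mul hq0 hq1 (z * q ^ n)
    have hP' := qPochInf_eq_mul hq0 hq1 (z * q ^ (n + 1))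
    rw [e1] at hP
    rw [e3] at hP'
    simp only [hg]
    rw [hP]
    set P1 := qPochInf (z * q ^ (n + 1)) q
    set P2 := qPochInf (z * q ^ (n + 2)) q
    set f0 := phi a b (s * q) q (z * q ^ n)
    set f1 := phi a b (s * q) q (z * q ^ (n + 1))
    set f2 := phi a b (s * q) q (z * q ^ (n + 2))
    linear_combination P1 * hphi - (s - a * b * (z * q ^ n)) * f2 * hP'
      + z * q ^ n * (1 - z * q ^ (n + 1)) * P2 * f2 * hprod
  have hg1 : ∃ C, ∀ n, ‖g n - 1‖ ≤ C * q ^ n := by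
    obtain ⟨C₁, h₁⟩ := norm_qPochInf_mul_sub_one_le hq0 hq1 z
    obtain ⟨C₂, h₂⟩ := norm_phi_mul_sub_one_le hq0 hq1 a b (s * q) hz
    refine ⟨C₁ * (C₂ + 1) + C₂, fun n => ?_⟩
    set P := qPochInf (z * q ^ n) q
    set f := phi a b (s * q) q (z * q ^ n)
    have hqn : q ^ n ≤ 1 := pow_le_one₀ hq0.le hq1.le
    have hC₂ : 0 ≤ C₂ := by simpa using (norm_nonneg _).trans (h₂ 0)
    have hf : ‖f‖ ≤ C₂ + 1 := by
      have h3 : ‖f‖ ≤ ‖f - 1‖ + ‖(1 : ℂ)‖ := norm_le_norm_sub_add _ _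
      rw [norm_one] at h3
      have := h₂ n
      nlinarith
    calc ‖g n - 1‖ = ‖(P - 1) * f + (f - 1)‖ := by congr 1; simp only [hg]; ring
      _ ≤ ‖P - 1‖ * ‖f‖ + ‖f - 1‖ := by rw [← norm_mul]; exact norm_add_le _ _
      _ ≤ (C₁ * q ^ n) * (C₂ + 1) + C₂ * q ^ n := by
        gcongr
        · exact (norm_nonneg _).trans (h₁ n)
        · exact h₁ n
        · exact h₂ n
      _ = _ := by ring
  obtain ⟨C, hC⟩ := hg1
  have key := eq_zero_of_q_recurrence (u := fun n => (starRingEnd ℂ) (g n) - g n) (C := 2 * C)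
    (b := (a + b) * z) (t := -(q * z) ^ 2) hq0 hq1 hs hsq ?_ ?_ 0
  · have := sub_eq_zero.mp key
    simpa [hg] using this
  · intro n
    have h1 : (starRingEnd ℂ) (g n) - g n = (starRingEnd ℂ) (g n - 1) - (g n - 1) := by
      simp
    have h2 := norm_sub_le ((starRingEnd ℂ) (g n - 1)) (g n - 1)
    rw [Complex.norm_conj] at h2
    show ‖(starRingEnd ℂ) (g n) - g n‖ ≤ _
    rw [h1]
    linarith [hC n]
  · intro n
    clear_value g
    have h := congrArg (starRingEnd ℂ) (hrec n)
    rw [map_sub, map_mul, map_mul, map_mul, map_sub, map_mul, map_mul, hab] at h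
    simp only [map_add, map_mul, map_neg, map_pow, map_one, Complex.conj_ofReal, hzc] at h
    linear_combination h - hrec n

theorem statement11 (q L η : ℝ) (hq0 : 0 < q) (hq1 : q < 1) (hL : -1 < L)
    (ρ : ℝ) (hρ : |ρ| < q ^ (-(1 : ℝ)/2)) :
    (qCoulomb q L η (ρ : ℂ)).im = 0 := by
  set z : ℂ := Complex.I * rpw q (1/2) * ρ with hz
  set a : ℂ := -(qcpow q ((L : ℂ) + (η : ℂ) * Complex.I + 1)) with ha
  set b : ℂ := qcpow q ((L : ℂ) - (η : ℂ) * Complex.I + 1) with hb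
  set s : ℝ := q ^ (2 * L + 1) with hs
  have hs0 : 0 < s := Real.rpow_pos_of_pos hq0 _
  have hsq : s * q = q ^ (2 * L + 2) := by
    rw [hs, ← Real.rpow_add_one hq0.ne']; congr 1; ring
  have hsq1 : s * q < 1 := by
    rw [hsq]; exact Real.rpow_lt_one hq0.le hq1 (by linarith)
  have hzn : ‖z‖ < 1 := by
    have hp : 0 < q ^ (1 / 2 : ℝ) := Real.rpow_pos_of_pos hq0 _
    have h1 : ‖z‖ = q ^ (1 / 2 : ℝ) * |ρ| := by
      rw [hz, rpw, norm_mul, norm_mul, Complex.norm_I, one_mul, Complex.norm_real,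
        Complex.norm_real, Real.norm_of_nonneg hp.le, Real.norm_eq_abs]
    rw [h1]
    calc q ^ (1 / 2 : ℝ) * |ρ| < q ^ (1 / 2 : ℝ) * q ^ (-(1 : ℝ) / 2) := by gcongr
      _ = 1 := by rw [← Real.rpow_add hq0]; norm_num
  have hzc : (starRingEnd ℂ) z = -z := by
    simp [hz, rpw]
  have hconj : ∀ w : ℂ, (starRingEnd ℂ) (qcpow q w) = qcpow q ((starRingEnd ℂ) w) := by
    intro w
    rw [qcpow, qcpow, ← Complex.exp_conj, map_mul, Complex.conj_ofReal]
  have hab : (starRingEnd ℂ) (a + b) = -(a + b) := by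
    rw [map_add, ha, hb, map_neg, hconj, hconj]
    simp only [map_add, map_sub, map_mul, map_one, Complex.conj_ofReal, Complex.conj_I, mul_neg,
      sub_neg_eq_add, ← sub_eq_add_neg]
    ring
  have hprod : a * b = -((s : ℂ) * q) := by
    rw [ha, hb, neg_mul, qcpow, qcpow, ← Complex.exp_add, ← Complex.ofReal_mul, hsq,
      Real.rpow_def_of_pos hq0, Complex.ofReal_exp]
    congr 2
    push_cast
    ring
  have hc : rpw q (2 * L + 2) = (s : ℂ) * q := by
    rw [rpw, ← hsq, Complex.ofReal_mul]
  have key := conj_qPochInf_mul_phi hq0 hq1 hs0 hsq1 hzn hzc hab hprod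
  rw [← hc] at key
  exact Complex.conj_eq_iff_im.mp key
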